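/- Let η ∈ (0,1] and let (A,B,C) be an η-strictly admissible ordered triple of Lebesgue measurable subsets of ℝ with positive, finite Lebesgue measures. Write D = D(A,B,C) for the Riesz–Sobolev deficit. Suppose that |A| = |B|, that D^{1/2} < (1/2) η |A|, and that |C| ≤ |A| − 4 D^{1/2}. Set γ = |A| − |C|. Then | |S_{A,−A}(γ)| − 2|C| | ≤ 8 D^{1/2}. -/

import Mathlib

open MeasureTheory Set Pointwise

/-- Lebesgue measure of a set of reals, as a real number. -/
noncomputable def lm (S : Set ℝ) : ℝ := (MeasureTheory.volume S).toReal

/-- Convolution of indicator functions: `(1_A ∗ 1_B)(x) = ∫ 1_A(y) 1_B(x−y) dy`. -/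
noncomputable def cv (A B : Set ℝ) (x : ℝ) : ℝ :=
  ∫ y, A.indicator (1 : ℝ → ℝ) y * B.indicator (1 : ℝ → ℝ) (x - y)

/-- The pairing `⟨1_A ∗ 1_B, 1_C⟩ = ∫ (1_A ∗ 1_B) · 1_C`. -/
noncomputable def pr (A B C : Set ℝ) : ℝ := ∫ x, cv A B x * C.indicator (1 : ℝ → ℝ) x

/-- The symmetric rearrangement `S⋆`: the open interval centered at 0 with `|S⋆| = |S|`. -/
noncomputable def sstar (S : Set ℝ) : Set ℝ := Set.Ioo (-(lm S / 2)) (lm S / 2)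

/-- The Riesz–Sobolev deficit `D(A,B,C) = ⟨1_{A⋆}∗1_{B⋆},1_{C⋆}⟩ − ⟨1_A∗1_B,1_C⟩`. -/
noncomputable def rsD (A B C : Set ℝ) : ℝ := pr (sstar A) (sstar B) (sstar C) - pr A B C

/-- The superlevel set `S_{A,B}(t) = {x : (1_A ∗ 1_B)(x) > t}`. -/
def slev (A B : Set ℝ) (t : ℝ) : Set ℝ := {x | cv A B x > t}

/-- The KPRGT deficit `D′(A,B,τ) = (|A|−τ)(|B|−τ) − ∫_τ^∞ |S_{A,B}(t)| dt`. -/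
noncomputable def kD (A B : Set ℝ) (τ : ℝ) : ℝ :=
  (lm A - τ) * (lm B - τ) - ∫ t in Set.Ioi τ, lm (slev A B t)

/-- `η`-strict admissibility of the ordered triple `(A,B,C)`:
`|X| + |Y| ≥ |Z| + η·max(|A|,|B|,|C|)` for every permutation `(X,Y,Z)` of `(A,B,C)`. -/
def adm (η : ℝ) (A B C : Set ℝ) : Prop :=
  lm A + lm B ≥ lm C + η * max (lm A) (max (lm B) (lm C)) ∧
  lm A + lm C ≥ lm B + η * max (lm A) (max (lm B) (lm C)) ∧
  lm B + lm C ≥ lm A + η * max (lm A) (max (lm B) (lm C))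

section Auxiliary

/-- The set whose measure is the value at `x` of the convolution of `1_A` and `1_B`. -/
def fiber (A B : Set ℝ) (x : ℝ) : Set ℝ := {y | y ∈ A ∧ x - y ∈ B}

/-- The integral of `(1_A ∗ 1_B - τ)⁺`. -/
noncomputable def excess (A B : Set ℝ) (τ : ℝ) : ENNReal :=
  ∫⁻ x, ENNReal.ofReal (cv A B x - τ)

variable {A B C : Set ℝ}

lemma lm_nonneg (S : Set ℝ) : 0 ≤ lm S := ENNReal.toReal_nonneg

lemma ofReal_lm (hA : volume A ≠ ⊤) : ENNReal.ofReal (lm A) = volume A :=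
  ENNReal.ofReal_toReal hA

lemma lm_mono (h : A ⊆ B) (hB : volume B ≠ ⊤) : lm A ≤ lm B :=
  ENNReal.toReal_mono hB (measure_mono h)

lemma measurableSet_reflect (hB : MeasurableSet B) (x : ℝ) :
    MeasurableSet {y | x - y ∈ B} :=
  (measurable_const.sub measurable_id) hB

lemma volume_reflect (B : Set ℝ) (x : ℝ) : volume {y | x - y ∈ B} = volume B := by
  simp_rw [sub_eq_add_neg]
  exact (Measure.measure_preimage_neg volume ((fun z => x + z) ⁻¹' B)).trans
    (measure_preimage_add volume x B)

lemma volume_translate (B : Set ℝ) (x : ℝ) : volume ((fun y => y - x) ⁻¹' B) = volume B := by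
  simp_rw [sub_eq_add_neg]
  exact measure_preimage_add_right volume (-x) B

lemma measurableSet_fiber (hA : MeasurableSet A) (hB : MeasurableSet B) (x : ℝ) :
    MeasurableSet (fiber A B x) :=
  hA.inter (measurableSet_reflect hB x)

lemma volume_fiber_ne_top (hAf : volume A ≠ ⊤) (x : ℝ) : volume (fiber A B x) ≠ ⊤ :=
  measure_ne_top_of_subset (fun _ hy => hy.1) hAf

lemma cv_eq_lm_fiber (hA : MeasurableSet A) (hB : MeasurableSet B) (x : ℝ) :
    cv A B x = lm (fiber A B x) := by
  have h : (fun y => A.indicator (1 : ℝ → ℝ) y * B.indicator (1 : ℝ → ℝ) (x - y))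
      = (fiber A B x).indicator (1 : ℝ → ℝ) := by
    funext y
    by_cases h1 : y ∈ A <;> by_cases h2 : x - y ∈ B <;> simp [fiber, h1, h2]
  rw [cv, h, integral_indicator_one (measurableSet_fiber hA hB x)]
  rfl

lemma ofReal_cv (hA : MeasurableSet A) (hB : MeasurableSet B) (hAf : volume A ≠ ⊤) (x : ℝ) :
    ENNReal.ofReal (cv A B x) = volume (fiber A B x) := by
  rw [cv_eq_lm_fiber hA hB, ofReal_lm (volume_fiber_ne_top hAf x)]

lemma cv_nonneg (hA : MeasurableSet A) (hB : MeasurableSet B) (x : ℝ) : 0 ≤ cv A B x := by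
  rw [cv_eq_lm_fiber hA hB]; exact lm_nonneg _

lemma measurableSet_fiber_prod (hA : MeasurableSet A) (hB : MeasurableSet B) :
    MeasurableSet {z : ℝ × ℝ | z.2 ∈ A ∧ z.1 - z.2 ∈ B} :=
  (measurable_snd hA).inter ((measurable_fst.sub measurable_snd) hB)

lemma measurable_cv (hA : MeasurableSet A) (hB : MeasurableSet B) : Measurable (cv A B) := by
  have h : cv A B = fun x => (volume (fiber A B x)).toReal :=
    funext fun x => cv_eq_lm_fiber hA hB x
  rw [h]
  exact (measurable_measure_prodMk_left (ν := (volume : Measure ℝ))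
    (measurableSet_fiber_prod hA hB)).ennreal_toReal

lemma lintegral_cv (hA : MeasurableSet A) (hB : MeasurableSet B) (hAf : volume A ≠ ⊤) :
    ∫⁻ x, ENNReal.ofReal (cv A B x) = volume A * volume B := by
  simp_rw [ofReal_cv hA hB hAf]
  have hS := measurableSet_fiber_prod hA hB
  have h1 := Measure.prod_apply (μ := (volume : Measure ℝ)) (ν := (volume : Measure ℝ)) hS
  have h2 := Measure.prod_apply_symm (μ := (volume : Measure ℝ)) (ν := (volume : Measure ℝ)) hS
  have h3 : ∀ y : ℝ, volume ((fun x => (x, y)) ⁻¹' {z : ℝ × ℝ | z.2 ∈ A ∧ z.1 - z.2 ∈ B})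
      = A.indicator (fun _ => volume B) y := by
    intro y
    by_cases hy : y ∈ A
    · rw [indicator_of_mem hy, ← volume_translate B y]
      congr 1
      ext x
      simp [hy]
    · simp [hy]
  simp_rw [h3] at h2
  rw [lintegral_indicator hA, setLIntegral_const] at h2
  rw [mul_comm, ← h2, h1]
  rfl

lemma integrable_cv (hA : MeasurableSet A) (hB : MeasurableSet B) (hAf : volume A ≠ ⊤)
    (hBf : volume B ≠ ⊤) : Integrable (cv A B) := by
  refine ⟨(measurable_cv hA hB).aestronglyMeasurable, ?_⟩
  rw [hasFiniteIntegral_iff_ofReal (Filter.Eventually.of_forall (cv_nonneg hA hB)),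
    lintegral_cv hA hB hAf]
  exact ENNReal.mul_lt_top hAf.lt_top hBf.lt_top

lemma measurableSet_slev (hA : MeasurableSet A) (hB : MeasurableSet B) (t : ℝ) :
    MeasurableSet (slev A B t) :=
  measurableSet_lt measurable_const (measurable_cv hA hB)

lemma exists_lm_inter_Iic_eq (hAf : volume A ≠ ⊤) {m : ℝ} (hm : 0 < m) (hmA : m < lm A) :
    ∃ p, lm (A ∩ Iic p) = m := by
  have : IsFiniteMeasure (volume.restrict A) := ⟨by simpa using hAf.lt_top⟩
  have hfin (p : ℝ) : volume (A ∩ Iic p) ≠ ⊤ := measure_ne_top_of_subset inter_subset_left hAf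
  have hrw (p : ℝ) : lm (A ∩ Iic p) = (volume.restrict A (Iic p)).toReal := by
    rw [Measure.restrict_apply measurableSet_Iic, inter_comm]; rfl
  have hcont : Continuous fun p => lm (A ∩ Iic p) := by
    refine (LipschitzWith.of_le_add (f := fun p => lm (A ∩ Iic p)) fun x y => ?_).continuous
    have hsub : A ∩ Iic x ⊆ (A ∩ Iic y) ∪ Ioc y x := by
      rintro z ⟨hz, hzx⟩
      rcases le_or_gt z y with h | h
      · exact Or.inl ⟨hz, h⟩
      · exact Or.inr ⟨h, hzx⟩
    have h1 : volume (A ∩ Iic x) ≤ volume (A ∩ Iic y) + ENNReal.ofReal (dist x y) :=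
      calc _ ≤ volume ((A ∩ Iic y) ∪ Ioc y x) := measure_mono hsub
        _ ≤ volume (A ∩ Iic y) + volume (Ioc y x) := measure_union_le _ _
        _ ≤ _ := by
          rw [Real.volume_Ioc]
          gcongr
          exact le_abs_self _
    have h2 := ENNReal.toReal_mono (ENNReal.add_ne_top.2 ⟨hfin y, ENNReal.ofReal_ne_top⟩) h1
    rwa [ENNReal.toReal_add (hfin y) ENNReal.ofReal_ne_top,
      ENNReal.toReal_ofReal dist_nonneg] at h2
  have hbot : Filter.Tendsto (fun p => lm (A ∩ Iic p)) Filter.atBot (nhds 0) := by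
    have h := tendsto_measure_iInter_atBot (μ := volume.restrict A) (s := fun p : ℝ => Iic p)
      (fun p => measurableSet_Iic.nullMeasurableSet) monotone_Iic ⟨0, measure_ne_top _ _⟩
    rw [iInter_Iic_eq_empty_iff.2 (by simp), measure_empty] at h
    simp_rw [hrw]
    simpa [Function.comp_def] using (ENNReal.tendsto_toReal ENNReal.zero_ne_top).comp h
  have htop : Filter.Tendsto (fun p => lm (A ∩ Iic p)) Filter.atTop (nhds (lm A)) := by
    simp_rw [hrw]
    have := (ENNReal.tendsto_toReal (measure_ne_top (volume.restrict A) univ)).comp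
      (tendsto_measure_Iic_atTop (volume.restrict A))
    simpa [lm, Function.comp_def] using this
  obtain ⟨x, hx⟩ := (hbot.eventually_lt_const hm).exists
  obtain ⟨y, hy⟩ := (htop.eventually_const_lt hmA).exists
  exact mem_range_of_exists_le_of_exists_ge hcont ⟨x, hx.le⟩ ⟨y, hy.le⟩

lemma lm_inter_Iic_add (hAf : volume A ≠ ⊤) (p : ℝ) :
    lm (A ∩ Iic p) + lm (A ∩ Ioi p) = lm A := by
  have h := measureReal_inter_add_sdiff (μ := volume) (s := A) (measurableSet_Iic (a := p)) hAf
  rw [sdiff_eq, compl_Iic] at h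
  exact h

lemma cv_le_left (hA : MeasurableSet A) (hB : MeasurableSet B) (hAf : volume A ≠ ⊤) (x : ℝ) :
    cv A B x ≤ lm A := by
  rw [cv_eq_lm_fiber hA hB]
  exact lm_mono (fun _ hy => hy.1) hAf

lemma cv_le_right (hA : MeasurableSet A) (hB : MeasurableSet B) (hBf : volume B ≠ ⊤) (x : ℝ) :
    cv A B x ≤ lm B := by
  rw [cv_eq_lm_fiber hA hB, lm, lm, ← volume_reflect B x]
  exact ENNReal.toReal_mono (by rwa [volume_reflect]) (measure_mono fun _ hy => hy.2)

lemma lm_union_le (A B : Set ℝ) : lm (A ∪ B) ≤ lm A + lm B := measureReal_union_le A B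

/-- The inequality of Kneser, Pollard, Ruzsa, Green and Tao on the real line. -/
lemma excess_le (hA : MeasurableSet A) (hB : MeasurableSet B) (hAf : volume A ≠ ⊤)
    (hBf : volume B ≠ ⊤) {t : ℝ} (ht : 0 ≤ t) (htA : t ≤ lm A) (htB : t ≤ lm B) :
    excess A B t ≤ ENNReal.ofReal ((lm A - t) * (lm B - t)) := by
  rcases ht.eq_or_lt with rfl | ht
  · simp only [excess, sub_zero]
    rw [lintegral_cv hA hB hAf, ENNReal.ofReal_mul (lm_nonneg A), ofReal_lm hAf, ofReal_lm hBf]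
  rcases htA.eq_or_lt with rfl | htA
  · have h (x : ℝ) : ENNReal.ofReal (cv A B x - lm A) = 0 :=
      ENNReal.ofReal_of_nonpos (sub_nonpos.2 (cv_le_left hA hB hAf x))
    simp [excess, h]
  rcases htB.eq_or_lt with rfl | htB
  · have h (x : ℝ) : ENNReal.ofReal (cv A B x - lm B) = 0 :=
      ENNReal.ofReal_of_nonpos (sub_nonpos.2 (cv_le_right hA hB hBf x))
    simp [excess, h]
  obtain ⟨p, hp⟩ := exists_lm_inter_Iic_eq hAf (sub_pos.2 htA) (sub_lt_self _ ht)
  obtain ⟨q, hq⟩ := exists_lm_inter_Iic_eq hBf ht htB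
  have hp' := lm_inter_Iic_add hAf p
  have hq' := lm_inter_Iic_add hBf q
  have hA1 := hA.inter (measurableSet_Iic (a := p))
  have hB2 := hB.inter (measurableSet_Ioi (a := q))
  have hA1f : volume (A ∩ Iic p) ≠ ⊤ := measure_ne_top_of_subset inter_subset_left hAf
  have hA2f : volume (A ∩ Ioi p) ≠ ⊤ := measure_ne_top_of_subset inter_subset_left hAf
  have hB1f : volume (B ∩ Iic q) ≠ ⊤ := measure_ne_top_of_subset inter_subset_left hBf
  have hB2f : volume (B ∩ Ioi q) ≠ ⊤ := measure_ne_top_of_subset inter_subset_left hBf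
  have key (x : ℝ) : cv A B x - t ≤ cv (A ∩ Iic p) (B ∩ Ioi q) x := by
    rw [cv_eq_lm_fiber hA hB, cv_eq_lm_fiber hA1 hB2]
    have hFf : volume (fiber (A ∩ Iic p) (B ∩ Ioi q) x) ≠ ⊤ := volume_fiber_ne_top hA1f x
    rcases le_or_gt x (p + q) with hx | hx
    · have hsub : fiber A B x ⊆
          fiber (A ∩ Iic p) (B ∩ Ioi q) x ∪ {y | x - y ∈ B ∩ Iic q} := by
        rintro y ⟨h1, h2⟩
        rcases le_or_gt (x - y) q with h | h
        · exact Or.inr ⟨h2, h⟩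
        · exact Or.inl ⟨⟨h1, mem_Iic.2 (by linarith)⟩, h2, h⟩
      have h3 : volume {y | x - y ∈ B ∩ Iic q} = volume (B ∩ Iic q) := volume_reflect _ x
      have h4 : lm {y | x - y ∈ B ∩ Iic q} = t := by rw [lm, h3]; exact hq
      have h5 := lm_mono hsub (measure_union_ne_top hFf (by rwa [h3]))
      have h6 := lm_union_le (fiber (A ∩ Iic p) (B ∩ Ioi q) x) {y | x - y ∈ B ∩ Iic q}
      linarith
    · have hsub : fiber A B x ⊆ fiber (A ∩ Iic p) (B ∩ Ioi q) x ∪ (A ∩ Ioi p) := by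
        rintro y ⟨h1, h2⟩
        rcases le_or_gt y p with h | h
        · exact Or.inl ⟨⟨h1, h⟩, h2, mem_Ioi.2 (by linarith)⟩
        · exact Or.inr ⟨h1, h⟩
      have h5 := lm_mono hsub (measure_union_ne_top hFf hA2f)
      have h6 := lm_union_le (fiber (A ∩ Iic p) (B ∩ Ioi q) x) (A ∩ Ioi p)
      linarith
  calc excess A B t ≤ ∫⁻ x, ENNReal.ofReal (cv (A ∩ Iic p) (B ∩ Ioi q) x) :=
        lintegral_mono fun x => ENNReal.ofReal_le_ofReal (key x)
    _ = volume (A ∩ Iic p) * volume (B ∩ Ioi q) := lintegral_cv hA1 hB2 hA1f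
    _ = ENNReal.ofReal (lm (A ∩ Iic p) * lm (B ∩ Ioi q)) := by
        rw [ENNReal.ofReal_mul (lm_nonneg _), ofReal_lm hA1f, ofReal_lm hB2f]
    _ = _ := by rw [hp, ← hq', hq, add_sub_cancel_left]

lemma excess_add_le (hA : MeasurableSet A) (hB : MeasurableSet B) (τ : ℝ) {δ : ℝ} (hδ : 0 ≤ δ) :
    excess A B (τ + δ) + ENNReal.ofReal δ * volume (slev A B (τ + δ)) ≤ excess A B τ := by
  have hm := measurable_cv hA hB
  have hS := measurableSet_slev hA hB (τ + δ)
  rw [excess, excess, ← lintegral_indicator_const hS, ← lintegral_add_left (by fun_prop)]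
  refine lintegral_mono fun x => ?_
  by_cases hx : x ∈ slev A B (τ + δ)
  · have : τ + δ < cv A B x := hx
    rw [indicator_of_mem hx, ← ENNReal.ofReal_add (by linarith) hδ]
    exact ENNReal.ofReal_le_ofReal (by linarith)
  · rw [indicator_of_notMem hx, add_zero]
    exact ENNReal.ofReal_le_ofReal (by linarith)

lemma excess_le_add (hA : MeasurableSet A) (hB : MeasurableSet B) (τ δ : ℝ) :
    excess A B τ ≤ excess A B (τ + δ) + ENNReal.ofReal δ * volume (slev A B τ) := by
  have hm := measurable_cv hA hB
  have hS := measurableSet_slev hA hB τ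
  rw [excess, excess, ← lintegral_indicator_const hS, ← lintegral_add_left (by fun_prop)]
  refine lintegral_mono fun x => ?_
  by_cases hx : x ∈ slev A B τ
  · rw [indicator_of_mem hx]
    calc ENNReal.ofReal (cv A B x - τ) = ENNReal.ofReal ((cv A B x - (τ + δ)) + δ) := by
          congr 1; ring
      _ ≤ _ := ENNReal.ofReal_add_le
  · have : cv A B x ≤ τ := not_lt.1 hx
    rw [ENNReal.ofReal_of_nonpos (by linarith)]
    exact zero_le

lemma lintegral_ofReal_sub_eq {f : ℝ → ℝ} (hf : Measurable f) (τ : ℝ) :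
    ∫⁻ x, ENNReal.ofReal (f x - τ) = ∫⁻ t in Ioi (0 : ℝ), volume {x | τ + t < f x} := by
  have h := lintegral_eq_lintegral_meas_lt volume (f := fun x => max (f x - τ) 0)
    (Filter.Eventually.of_forall fun x => le_max_right _ _)
    ((hf.sub_const τ).max measurable_const).aemeasurable
  have h1 (x : ℝ) : ENNReal.ofReal (max (f x - τ) 0) = ENNReal.ofReal (f x - τ) := by
    rw [ENNReal.ofReal_max, ENNReal.ofReal_zero, max_eq_left zero_le]
  simp_rw [h1] at h
  rw [h]
  refine setLIntegral_congr_fun measurableSet_Ioi fun t ht => ?_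
  have ht' : ¬ t < 0 := not_lt.2 (le_of_lt ht)
  congr 1
  ext x
  simp only [mem_ofPred_eq, lt_max_iff, ht', or_false, lt_sub_iff_add_lt']

/-- A form of the one-dimensional Brunn–Minkowski inequality for difference sets. -/
lemma two_mul_volume_le {S T : Set ℝ} (hS : MeasurableSet S)
    (hSf : volume S ≠ ⊤) (hST : ∀ x ∈ S, ∀ y ∈ S, x - y ∈ T) :
    2 * volume S ≤ volume T := by
  by_cases hTf : volume T = ⊤
  · rw [hTf]; exact le_top
  have hneg : volume (-S) = volume S := Measure.measure_neg volume S
  have hnf : volume (-S) ≠ ⊤ := by rwa [hneg]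
  have hln : lm (-S) = lm S := by rw [lm, hneg]; rfl
  have hzero : excess S (-S) 0 = ENNReal.ofReal (lm S * lm S) := by
    simp only [excess, sub_zero]
    rw [lintegral_cv hS hS.neg hSf, hneg, ENNReal.ofReal_mul (lm_nonneg S), ofReal_lm hSf]
  have hsupp : slev S (-S) 0 ⊆ T := by
    intro x hx
    have hx' : 0 < cv S (-S) x := hx
    rw [cv_eq_lm_fiber hS hS.neg] at hx'
    have hne : (fiber S (-S) x).Nonempty := by
      by_contra h
      rw [not_nonempty_iff_eq_empty.1 h] at hx'
      simp [lm] at hx'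
    obtain ⟨y, h1, h2⟩ := hne
    have := hST y h1 (-(x - y)) h2
    simpa using this
  have main : ∀ t, 0 < t → t ≤ lm S → 2 * lm S - t ≤ lm T := by
    intro t ht htS
    have h1 := excess_le_add hS hS.neg 0 t
    rw [hzero, zero_add] at h1
    have h2 := excess_le hS hS.neg hSf hnf ht.le htS (by rwa [hln])
    rw [hln] at h2
    have h3 : ENNReal.ofReal (lm S * lm S) ≤
        ENNReal.ofReal ((lm S - t) * (lm S - t) + t * lm T) := by
      rw [ENNReal.ofReal_add (mul_self_nonneg _) (mul_nonneg ht.le (lm_nonneg T)),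
        ENNReal.ofReal_mul ht.le, ofReal_lm hTf]
      exact h1.trans (add_le_add h2 (by gcongr))
    have h4 := (ENNReal.ofReal_le_ofReal_iff
      (add_nonneg (mul_self_nonneg _) (mul_nonneg ht.le (lm_nonneg T)))).1 h3
    have h5 : t * (2 * lm S - t) ≤ t * lm T := by nlinarith
    exact le_of_mul_le_mul_left h5 ht
  have hfin : 2 * lm S ≤ lm T := by
    rcases (lm_nonneg S).eq_or_lt with h | h
    · rw [← h]; simpa using lm_nonneg T
    · by_contra! hlt
      have h1 := main (min (lm S) ((2 * lm S - lm T) / 2))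
        (lt_min h (by linarith)) (min_le_left _ _)
      have h2 := min_le_right (lm S) ((2 * lm S - lm T) / 2)
      linarith
  rw [← ofReal_lm hSf, ← ofReal_lm hTf, ← ENNReal.ofReal_ofNat 2,
    ← ENNReal.ofReal_mul (by norm_num)]
  exact ENNReal.ofReal_le_ofReal hfin

lemma lt_cv_neg (hA : MeasurableSet A) (hB : MeasurableSet B) (hAf : volume A ≠ ⊤)
    (hBf : volume B ≠ ⊤) {s x y : ℝ} (hx : s < cv A B x) (hy : s < cv A B y) :
    2 * s - lm B < cv A (-A) (x - y) := by
  rw [cv_eq_lm_fiber hA hB] at hx hy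
  rw [cv_eq_lm_fiber hA hA.neg]
  set E := fiber A B x
  set F := (fun z => z - (x - y)) ⁻¹' fiber A B y with hF
  have hEm : MeasurableSet E := measurableSet_fiber hA hB x
  have hFm : MeasurableSet F := (measurable_id.sub_const _) (measurableSet_fiber hA hB y)
  have hFv : volume F = volume (fiber A B y) := volume_translate _ _
  have hFl : lm F = lm (fiber A B y) := by rw [lm, hFv]; rfl
  have hEf : volume E ≠ ⊤ := volume_fiber_ne_top hAf x
  have hFf : volume F ≠ ⊤ := by rw [hFv]; exact volume_fiber_ne_top hAf y
  have hunion : lm (E ∪ F) ≤ lm B := by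
    have hsub : E ∪ F ⊆ {z | x - z ∈ B} := by
      rintro z (hz | hz)
      · exact hz.2
      · have h : y - (z - (x - y)) ∈ B := hz.2
        have h' : y - (z - (x - y)) = x - z := by ring
        rwa [h'] at h
    have h := lm_mono hsub (by rwa [volume_reflect])
    rwa [lm, lm, volume_reflect] at h
  have hinter : lm (E ∩ F) ≤ lm (fiber A (-A) (x - y)) := by
    refine lm_mono ?_ (volume_fiber_ne_top hAf _)
    rintro z ⟨hz, hz'⟩
    refine ⟨hz.1, ?_⟩
    have h : z - (x - y) ∈ A := hz'.1
    simpa using h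
  have hsum : lm (E ∪ F) + lm (E ∩ F) = lm E + lm F :=
    measureReal_union_add_inter hFm hEf hFf
  linarith

lemma volume_slev_ne_top (hA : MeasurableSet A) (hB : MeasurableSet B) (hAf : volume A ≠ ⊤)
    (hBf : volume B ≠ ⊤) {s : ℝ} (hs : 0 < s) : volume (slev A B s) ≠ ⊤ := by
  have h := excess_add_le hA hB 0 hs.le
  have h0 := excess_le hA hB hAf hBf le_rfl (lm_nonneg A) (lm_nonneg B)
  rw [zero_add] at h
  intro htop
  rw [htop, ENNReal.mul_top (by simpa using hs), add_top] at h
  exact absurd (h.trans h0) (by simp)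

lemma two_mul_volume_slev_le (hA : MeasurableSet A) (hB : MeasurableSet B) (hAf : volume A ≠ ⊤)
    (hBf : volume B ≠ ⊤) {s : ℝ} (hs : 0 < s) :
    2 * volume (slev A B s) ≤ volume (slev A (-A) (2 * s - lm B)) :=
  two_mul_volume_le (measurableSet_slev hA hB s)
    (volume_slev_ne_top hA hB hAf hBf hs)
    fun _ hx _ hy => lt_cv_neg hA hB hAf hBf hx hy

lemma excess_neg_ge (hA : MeasurableSet A) (hB : MeasurableSet B) (hAf : volume A ≠ ⊤)
    (hBf : volume B ≠ ⊤) {τ : ℝ} (hτ : 0 < τ) (u : ℝ) :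
    4 * excess A B τ + ENNReal.ofReal u *
      (volume (slev A (-A) (2 * τ - lm B + u)) - 2 * volume (slev A B τ))
      ≤ excess A (-A) (2 * τ - lm B) := by
  have hm := measurable_cv hA hB
  have h1 : 2 * excess A B τ = ∫⁻ t in Ioi (0 : ℝ), volume (slev A B (τ + t / 2)) := by
    have h := lintegral_ofReal_sub_eq (hm.const_mul 2) (2 * τ)
    simp_rw [← mul_sub, ENNReal.ofReal_mul (zero_le_two (α := ℝ)), ENNReal.ofReal_ofNat] at h
    rw [lintegral_const_mul _ (by fun_prop)] at h
    rw [excess, h]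
    refine lintegral_congr fun t => ?_
    congr 1
    ext x
    simp only [slev, mem_ofPred_eq]
    constructor <;> intro h <;> linarith
  have h2 : excess A (-A) (2 * τ - lm B)
      = ∫⁻ t in Ioi (0 : ℝ), volume (slev A (-A) (2 * τ - lm B + t)) :=
    lintegral_ofReal_sub_eq (measurable_cv hA hA.neg) _
  set r := volume (slev A (-A) (2 * τ - lm B + u)) - 2 * volume (slev A B τ) with hr
  have h3 : ENNReal.ofReal u * r
      = ∫⁻ t in Ioi (0 : ℝ), (Iio u).indicator (fun _ => r) t := by
    rw [setLIntegral_indicator measurableSet_Iio, setLIntegral_const, Iio_inter_Ioi,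
      Real.volume_Ioo, sub_zero, mul_comm]
  have h4 : (4 : ENNReal) * excess A B τ = 2 * (2 * excess A B τ) := by
    rw [← mul_assoc]; norm_num
  have hanti : Antitone fun t => volume (slev A B (τ + t / 2)) := by
    intro s t hst
    refine measure_mono fun x hx => ?_
    have : τ + t / 2 < cv A B x := hx
    show τ + s / 2 < cv A B x
    linarith
  rw [h4, h1, h2, h3, ← lintegral_const_mul _ hanti.measurable,
    ← lintegral_add_left (hanti.measurable.const_mul 2)]
  refine setLIntegral_mono' measurableSet_Ioi fun t ht => ?_
  have ht : 0 < t := ht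
  by_cases htu : t < u
  · rw [indicator_of_mem (mem_Iio.2 htu)]
    by_cases hle : volume (slev A (-A) (2 * τ - lm B + u)) ≤ 2 * volume (slev A B τ)
    · rw [hr, tsub_eq_zero_of_le hle, add_zero]
      have h := two_mul_volume_slev_le hA hB hAf hBf (s := τ + t / 2) (by linarith)
      rwa [show 2 * (τ + t / 2) - lm B = 2 * τ - lm B + t by ring] at h
    · have ha := hanti ht.le
      simp only [zero_div, add_zero] at ha
      calc 2 * volume (slev A B (τ + t / 2)) + r ≤ 2 * volume (slev A B τ) + r := by gcongr
        _ = volume (slev A (-A) (2 * τ - lm B + u)) := by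
            rw [hr, add_tsub_cancel_of_le (le_of_not_ge hle)]
        _ ≤ _ := by
            refine measure_mono fun x hx => ?_
            have : 2 * τ - lm B + u < cv A (-A) x := hx
            show 2 * τ - lm B + t < cv A (-A) x
            linarith
  · rw [indicator_of_notMem (by simpa using htu), add_zero]
    have h := two_mul_volume_slev_le hA hB hAf hBf (s := τ + t / 2) (by linarith)
    rwa [show 2 * (τ + t / 2) - lm B = 2 * τ - lm B + t by ring] at h

lemma pr_eq_setIntegral (hC : MeasurableSet C) : pr A B C = ∫ x in C, cv A B x := by
  rw [pr, ← integral_indicator hC]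
  congr 1
  funext x
  by_cases hx : x ∈ C <;> simp [hx]

lemma pr_sstar_ge (hAB : lm A = lm B) :
    lm A * lm C - lm C ^ 2 / 4 ≤ pr (sstar A) (sstar B) (sstar C) := by
  have hs (S : Set ℝ) : MeasurableSet (sstar S) := measurableSet_Ioo
  have hf (S : Set ℝ) : volume (sstar S) ≠ ⊤ := by simp [sstar]
  have hc := lm_nonneg C
  rw [pr_eq_setIntegral (hs C)]
  have hpt (x : ℝ) : lm A - |x| ≤ cv (sstar A) (sstar B) x := by
    rw [cv_eq_lm_fiber (hs A) (hs B)]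
    have hsub : Ioo (max (-(lm A / 2)) (x - lm A / 2)) (min (lm A / 2) (x + lm A / 2))
        ⊆ fiber (sstar A) (sstar B) x := by
      intro y hy
      simp only [mem_Ioo, max_lt_iff, lt_min_iff] at hy
      refine ⟨⟨hy.1.1, hy.2.1⟩, ?_, ?_⟩ <;> rw [← hAB] <;> linarith
    refine le_trans ?_ (lm_mono hsub (volume_fiber_ne_top (hf A) x))
    change lm A - |x| ≤ (volume (Ioo _ _)).toReal
    rw [Real.volume_Ioo]
    refine le_trans ?_ (le_max_left _ _)
    rcases abs_cases x with ⟨h, h'⟩ | ⟨h, h'⟩ <;> rw [h]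
    · rw [max_eq_right (by linarith), min_eq_left (by linarith)]; linarith
    · rw [max_eq_left (by linarith), min_eq_right (by linarith)]; linarith
  have hint : ∫ x in sstar C, (lm A - |x|) = lm A * lm C - lm C ^ 2 / 4 := by
    rw [sstar, ← integral_Ioc_eq_integral_Ioo,
      ← intervalIntegral.integral_of_le (by linarith)]
    have hcont : Continuous fun x : ℝ => lm A - |x| := by fun_prop
    rw [← intervalIntegral.integral_add_adjacent_intervals
      (hcont.intervalIntegrable (-(lm C / 2)) 0) (hcont.intervalIntegrable 0 (lm C / 2))]
    have e1 : ∫ x in (-(lm C / 2))..0, (lm A - |x|) = ∫ x in (-(lm C / 2))..0, (lm A + x) := by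
      refine intervalIntegral.integral_congr fun x hx => ?_
      rw [uIcc_of_le (by linarith)] at hx
      simp [abs_of_nonpos hx.2]
    have e2 : ∫ x in (0 : ℝ)..(lm C / 2), (lm A - |x|) = ∫ x in (0 : ℝ)..(lm C / 2), (lm A - x) := by
      refine intervalIntegral.integral_congr fun x hx => ?_
      rw [uIcc_of_le (by linarith)] at hx
      simp [abs_of_nonneg hx.1]
    rw [e1, e2, intervalIntegral.integral_add (by simp) (by simp),
      intervalIntegral.integral_sub (by simp) (by simp)]
    simp
    ring
  rw [← hint]
  refine setIntegral_mono_on ?_ (integrable_cv (hs A) (hs B) (hf A) (hf B)).integrableOn (hs C)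
    fun x _ => hpt x
  have hcont : Continuous fun x : ℝ => lm A - |x| := by fun_prop
  exact (hcont.integrableOn_Icc (a := -(lm C / 2)) (b := lm C / 2)).mono_set Ioo_subset_Icc_self

lemma pr_le (hA : MeasurableSet A) (hB : MeasurableSet B) (hC : MeasurableSet C)
    (hAf : volume A ≠ ⊤) (hBf : volume B ≠ ⊤) (hCf : volume C ≠ ⊤) {τ : ℝ} (hτ : 0 ≤ τ) :
    pr A B C ≤ τ * lm C + (excess A B τ).toReal := by
  have hm := measurable_cv hA hB
  have hfin : excess A B τ ≠ ⊤ := by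
    refine ne_top_of_le_ne_top (ENNReal.mul_ne_top hAf hBf) ?_
    rw [← lintegral_cv hA hB hAf]
    exact lintegral_mono fun x => ENNReal.ofReal_le_ofReal (by linarith)
  rw [pr_eq_setIntegral hC, integral_eq_lintegral_of_nonneg_ae
    (Filter.Eventually.of_forall (cv_nonneg hA hB)) hm.aestronglyMeasurable]
  have h : ∫⁻ x in C, ENNReal.ofReal (cv A B x)
      ≤ ENNReal.ofReal τ * volume C + excess A B τ := by
    calc ∫⁻ x in C, ENNReal.ofReal (cv A B x)
        ≤ ∫⁻ x in C, (ENNReal.ofReal τ + ENNReal.ofReal (cv A B x - τ)) := by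
          refine lintegral_mono fun x => ?_
          calc ENNReal.ofReal (cv A B x) = ENNReal.ofReal (τ + (cv A B x - τ)) := by
                rw [add_sub_cancel]
            _ ≤ _ := ENNReal.ofReal_add_le
      _ = ENNReal.ofReal τ * volume C + ∫⁻ x in C, ENNReal.ofReal (cv A B x - τ) := by
          rw [lintegral_add_left measurable_const, setLIntegral_const]
      _ ≤ _ := by
          gcongr
          exact setLIntegral_le_lintegral _ _
  have h1 : ENNReal.ofReal τ * volume C ≠ ⊤ := ENNReal.mul_ne_top ENNReal.ofReal_ne_top hCf
  refine (ENNReal.toReal_mono (ENNReal.add_ne_top.2 ⟨h1, hfin⟩) h).trans ?_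
  rw [ENNReal.toReal_add h1 hfin, ENNReal.toReal_mul, ENNReal.toReal_ofReal hτ]
  rfl

end Auxiliary


/-- Near equality in the Riesz–Sobolev inequality when `|A| = |B|`:
the measure of the superlevel set `S_{A,−A}(|A|−|C|)` is nearly `2|C|`. -/
theorem equal_measure_case_main_step (η : ℝ) (hη0 : 0 < η) (hη1 : η ≤ 1)
    (A B C : Set ℝ)
    (hA : MeasurableSet A) (hB : MeasurableSet B) (hC : MeasurableSet C)
    (hA0 : 0 < volume A) (hAf : volume A ≠ ⊤)
    (hB0 : 0 < volume B) (hBf : volume B ≠ ⊤)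
    (hC0 : 0 < volume C) (hCf : volume C ≠ ⊤)
    (hadm : adm η A B C)
    (hAB : lm A = lm B)
    (hD : Real.sqrt (rsD A B C) < (1/2) * η * lm A)
    (hAC : lm C ≤ lm A - 4 * Real.sqrt (rsD A B C)) :
    |lm (slev A (-A) (lm A - lm C)) - 2 * lm C| ≤ 8 * Real.sqrt (rsD A B C) := by
  set ε := Real.sqrt (rsD A B C) with hε
  set a := lm A with ha
  set c := lm C with hc
  set τ := a - c / 2 with hτ
  have hε0 : 0 ≤ ε := Real.sqrt_nonneg _
  have hc0 : 0 < c := ENNReal.toReal_pos hC0.ne' hCf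
  have hcε : 2 * ε < c := by
    have h1 := hadm.2.2
    have h2 : η * a ≤ η * max (lm A) (max (lm B) (lm C)) := by
      gcongr; exact le_max_left _ _
    rw [← hAB] at h1 h2
    linarith
  have hτ0 : 0 < τ := by linarith
  have hτa : 2 * τ - lm B = a - c := by rw [← hAB]; ring
  have hneg : volume (-A) = volume A := Measure.measure_neg volume A
  have hnf : volume (-A) ≠ ⊤ := by rwa [hneg]
  have hln : lm (-A) = a := by rw [lm, hneg]; rfl
  have hkp {t : ℝ} (h0 : 0 ≤ t) (h1 : t ≤ a) : excess A B t ≤ ENNReal.ofReal ((a - t) ^ 2) := by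
    have h := excess_le hA hB hAf hBf h0 h1 (hAB ▸ h1)
    rwa [← hAB, ← pow_two] at h
  have hkn {t : ℝ} (h0 : 0 ≤ t) (h1 : t ≤ a) :
      excess A (-A) t ≤ ENNReal.ofReal ((a - t) ^ 2) := by
    have h := excess_le hA hA.neg hAf hnf h0 h1 (hln.symm ▸ h1)
    rwa [hln, ← pow_two] at h
  have hEf : excess A B τ ≠ ⊤ := ne_top_of_le_ne_top ENNReal.ofReal_ne_top (hkp hτ0.le (by linarith))
  set E := (excess A B τ).toReal with hE
  have hE0 : 0 ≤ E := ENNReal.toReal_nonneg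
  have hEeq : excess A B τ = ENNReal.ofReal E := (ENNReal.ofReal_toReal hEf).symm
  have hEle : E ≤ c ^ 2 / 4 := by
    have h := hkp hτ0.le (by linarith)
    rw [hEeq, ENNReal.ofReal_le_ofReal_iff (sq_nonneg _)] at h
    rw [hτ] at h
    linarith
  have hDE : c ^ 2 / 4 - E ≤ rsD A B C := by
    have h1 := pr_sstar_ge (C := C) hAB
    have h2 := pr_le hA hB hC hAf hBf hCf hτ0.le
    rw [rsD]
    have h3 : τ * c = a * c - c ^ 2 / 2 := by rw [hτ]; ring
    linarith
  have hEge : c ^ 2 / 4 - ε ^ 2 ≤ E := by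
    rw [hε, Real.sq_sqrt (by linarith)]
    linarith
  have hSf : volume (slev A B τ) ≠ ⊤ := volume_slev_ne_top hA hB hAf hBf hτ0
  set σ := lm (slev A B τ) with hσ
  have hσ0 : 0 ≤ σ := lm_nonneg _
  have hσeq : volume (slev A B τ) = ENNReal.ofReal σ := (ofReal_lm hSf).symm
  have hlow : ∀ δ, 0 < δ → δ ≤ c / 2 → c * δ - δ ^ 2 - ε ^ 2 ≤ δ * σ := by
    intro δ h0 h1
    have h := excess_le_add hA hB τ δ
    have h2 := hkp (t := τ + δ) (by linarith) (by linarith)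
    have h3 := h.trans (add_le_add_left h2 _)
    rw [hEeq, hσeq, ← ENNReal.ofReal_mul h0.le,
      ← ENNReal.ofReal_add (sq_nonneg _) (mul_nonneg h0.le hσ0),
      ENNReal.ofReal_le_ofReal_iff (add_nonneg (sq_nonneg _) (mul_nonneg h0.le hσ0))] at h3
    have h4 : a - (τ + δ) = c / 2 - δ := by rw [hτ]; ring
    rw [h4] at h3
    nlinarith
  have hσge : c - 2 * ε ≤ σ := by
    rcases hε0.eq_or_lt with h0 | h0
    · by_contra! hlt
      have h1 := hlow (min (c / 2) ((c - σ) / 2)) (lt_min (by linarith) (by linarith))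
        (min_le_left _ _)
      have h2 := min_le_right (c / 2) ((c - σ) / 2)
      have h3 : 0 < min (c / 2) ((c - σ) / 2) := lt_min (by linarith) (by linarith)
      rw [← h0] at h1
      nlinarith
    · have h1 := hlow ε h0 (by linarith)
      have h2 : ε * (c - 2 * ε) ≤ ε * σ := by linarith
      exact le_of_mul_le_mul_left h2 h0
  have hTS : 2 * volume (slev A B τ) ≤ volume (slev A (-A) (a - c)) := by
    have h := two_mul_volume_slev_le hA hB hAf hBf hτ0
    rwa [hτa] at h
  have hup : volume (slev A (-A) (a - c)) ≤ ENNReal.ofReal (2 * c + 4 * ε) := by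
    rcases hε0.eq_or_lt with h0 | h0
    · have hEc : E = c ^ 2 / 4 := by rw [← h0] at hEge; linarith
      have hσle : σ ≤ c := by
        by_contra! hlt
        set δ := min τ ((σ - c) / 2) with hδ
        have hδ0 : 0 < δ := lt_min hτ0 (by linarith)
        have hδ1 : δ ≤ τ := min_le_left _ _
        have hδ2 : δ ≤ (σ - c) / 2 := min_le_right _ _
        have h1 := excess_add_le hA hB (τ - δ) hδ0.le
        have h2 := h1.trans (hkp (t := τ - δ) (by linarith) (by linarith))
        rw [sub_add_cancel, hEeq, hσeq, ← ENNReal.ofReal_mul hδ0.le,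
          ← ENNReal.ofReal_add hE0 (mul_nonneg hδ0.le hσ0),
          ENNReal.ofReal_le_ofReal_iff (sq_nonneg _)] at h2
        have h4 : a - (τ - δ) = c / 2 + δ := by rw [hτ]; ring
        rw [h4] at h2
        nlinarith
      have hgt : ∀ u, 0 < u → volume (slev A (-A) (a - c + u)) ≤ ENNReal.ofReal (2 * c) := by
        intro u hu
        have h1 := (hτa ▸ excess_neg_ge hA hB hAf hBf hτ0 u).trans
          (hkn (t := a - c) (by linarith) (by linarith))
        have h2 : (4 : ENNReal) * excess A B τ = ENNReal.ofReal (c ^ 2) := by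
          rw [hEeq, hEc, ← ENNReal.ofReal_ofNat 4, ← ENNReal.ofReal_mul (by norm_num)]
          congr 1; ring
        rw [h2, sub_sub_cancel] at h1
        have h3 : ENNReal.ofReal u *
            (volume (slev A (-A) (a - c + u)) - 2 * volume (slev A B τ)) = 0 := by
          have h4 : ENNReal.ofReal (c ^ 2) + ENNReal.ofReal u *
              (volume (slev A (-A) (a - c + u)) - 2 * volume (slev A B τ))
              ≤ ENNReal.ofReal (c ^ 2) + 0 := by rwa [add_zero]
          exact le_antisymm ((ENNReal.add_le_add_iff_left ENNReal.ofReal_ne_top).1 h4) zero_le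
        rcases mul_eq_zero.1 h3 with h | h
        · exact absurd (ENNReal.ofReal_eq_zero.1 h) (not_le.2 hu)
        · refine (tsub_eq_zero_iff_le.1 h).trans ?_
          rw [hσeq, ← ENNReal.ofReal_ofNat 2, ← ENNReal.ofReal_mul (by norm_num)]
          exact ENNReal.ofReal_le_ofReal (by linarith)
      have hU : slev A (-A) (a - c) = ⋃ n : ℕ, slev A (-A) (a - c + 1 / ((n : ℝ) + 1)) := by
        ext x
        simp only [mem_iUnion, slev, mem_ofPred_eq, gt_iff_lt]
        constructor
        · intro h
          obtain ⟨n, hn⟩ := exists_nat_one_div_lt (sub_pos.2 h)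
          exact ⟨n, by linarith⟩
        · rintro ⟨n, hn⟩
          have : (0 : ℝ) < 1 / ((n : ℝ) + 1) := by positivity
          linarith
      have hmono : Monotone fun n : ℕ => slev A (-A) (a - c + 1 / ((n : ℝ) + 1)) := by
        intro m n hmn x hx
        have h1 : a - c + 1 / ((m : ℝ) + 1) < cv A (-A) x := hx
        have h2 : 1 / ((n : ℝ) + 1) ≤ 1 / ((m : ℝ) + 1) := Nat.one_div_le_one_div hmn
        show a - c + 1 / ((n : ℝ) + 1) < cv A (-A) x
        linarith
      rw [hU, hmono.measure_iUnion, ← h0, mul_zero, add_zero]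
      exact iSup_le fun n => hgt _ (by positivity)
    · have h1 := hτa ▸ excess_neg_ge hA hB hAf hBf hτ0 0
      rw [ENNReal.ofReal_zero, zero_mul, add_zero] at h1
      have h2 := excess_add_le hA hA.neg (a - c - 2 * ε) (δ := 2 * ε) (by linarith)
      rw [sub_add_cancel] at h2
      have h3 := ((add_le_add_left h1 _).trans h2).trans
        (hkn (t := a - c - 2 * ε) (by linarith) (by linarith))
      have hTf : volume (slev A (-A) (a - c)) ≠ ⊤ :=
        volume_slev_ne_top hA hA.neg hAf hnf (by linarith)
      have hT0 := lm_nonneg (slev A (-A) (a - c))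
      rw [← ofReal_lm hTf] at h3 ⊢
      rw [hEeq, ← ENNReal.ofReal_ofNat 4, ← ENNReal.ofReal_mul (by norm_num),
        ← ENNReal.ofReal_mul (by linarith), ← ENNReal.ofReal_add (by positivity) (by positivity),
        ENNReal.ofReal_le_ofReal_iff (sq_nonneg _)] at h3
      refine ENNReal.ofReal_le_ofReal ?_
      have h5 : 2 * ε * lm (slev A (-A) (a - c)) ≤ 2 * ε * (2 * c + 4 * ε) := by nlinarith
      exact le_of_mul_le_mul_left h5 (by linarith)
  have hTf : volume (slev A (-A) (a - c)) ≠ ⊤ := ne_top_of_le_ne_top ENNReal.ofReal_ne_top hup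
  have hT1 : lm (slev A (-A) (a - c)) ≤ 2 * c + 4 * ε :=
    ENNReal.toReal_le_of_le_ofReal (by linarith) hup
  have hT2 : 2 * σ ≤ lm (slev A (-A) (a - c)) := by
    have h := ENNReal.toReal_mono hTf hTS
    rwa [ENNReal.toReal_mul, ENNReal.toReal_ofNat] at h
  rw [abs_le]
  constructor <;> linarith
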